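/- Let λ = ( (1/2) · ∏_{p prime, p ≡ 3 (mod 4)} 1/(1 − p^(−2)) )^(1/2) be the Landau–Ramanujan constant. Then λ = (1/√2) · ∏_{n=1}^∞ [ (1 − 2^(−2^n)) · ζ(2^n) / β(2^n) ]^(1 / 2^(n+1)), where the infinite product over n converges. -/

import Mathlib

/-- The Dirichlet beta function `β(s) = ∑_{k=0}^∞ (-1)^k / (2k+1)^s`. -/
noncomputable def dirichletBeta (s : ℂ) : ℂ :=
  ∑' k : ℕ, (-1) ^ k / ((2 * (k : ℂ) + 1) ^ s)

open Filter Topology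

/-- The nontrivial Dirichlet character modulo `4`, with complex values. -/
noncomputable def chiFour : DirichletCharacter ℂ 4 :=
  ZMod.χ₄.ringHomComp (Int.castRingHom ℂ)

lemma chiFour_natCast (n : ℕ) :
    chiFour (n : ZMod 4) = if n % 2 = 0 then 0 else if n % 4 = 1 then 1 else -1 := by
  have h : chiFour (n : ZMod 4) = ((ZMod.χ₄ (n : ZMod 4) : ℤ) : ℂ) := rfl
  rw [h, ZMod.χ₄_nat_eq_if_mod_four]
  split_ifs <;> simp

lemma chiFour_two_mul_add_one (k : ℕ) : chiFour ((2 * k + 1 : ℕ) : ZMod 4) = (-1) ^ k := by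
  rw [chiFour_natCast, if_neg (by omega)]
  rcases Nat.even_or_odd k with hk | hk
  · rw [hk.neg_one_pow, if_pos (by obtain ⟨m, rfl⟩ := hk; omega)]
  · rw [hk.neg_one_pow, if_neg (by obtain ⟨m, rfl⟩ := hk; omega)]

lemma dirichletBeta_eq_LSeries (s : ℂ) :
    dirichletBeta s = LSeries (fun n : ℕ => chiFour (n : ZMod 4)) s := by
  have hinj : Function.Injective (fun k : ℕ => 2 * k + 1) := fun a b h => by
    simpa using h
  rw [LSeries, dirichletBeta,
    ← hinj.tsum_eq (f := LSeries.term (fun n : ℕ => chiFour (n : ZMod 4)) s)]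
  · refine tsum_congr fun k => ?_
    rw [LSeries.term_of_ne_zero (by omega), chiFour_two_mul_add_one]
    push_cast
    rfl
  · intro n hn
    by_contra hodd
    refine hn ?_
    have h0 : n % 2 = 0 := by
      by_contra h
      exact hodd ⟨n / 2, by dsimp only; omega⟩
    rcases eq_or_ne n 0 with rfl | hn0
    · simp
    · rw [LSeries.term_of_ne_zero hn0, chiFour_natCast, if_pos h0, zero_div]

/-- The primes congruent to `3` modulo `4`. -/
abbrev PrimeThreeModFour : Type := {p : ℕ // p.Prime ∧ p % 4 = 3}

lemma PrimeThreeModFour.one_div_pow_mem {m : ℕ} (hm : m ≠ 0) (p : PrimeThreeModFour) :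
    0 < 1 / ((p : ℕ) : ℝ) ^ m ∧ 1 / ((p : ℕ) : ℝ) ^ m < 1 := by
  have hp : (1 : ℝ) < (p : ℕ) := by exact_mod_cast p.2.1.one_lt
  have hpm : 1 < ((p : ℕ) : ℝ) ^ m := one_lt_pow₀ hp hm
  exact ⟨by positivity, by rw [div_lt_one (by positivity)]; exact hpm⟩

/-- The logarithm of the Euler product over the primes congruent to `3` modulo `4`. -/
noncomputable def logPrimeProduct (m : ℕ) : ℝ :=
  ∑' p : PrimeThreeModFour, -Real.log (1 - 1 / ((p : ℕ) : ℝ) ^ m)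

lemma hasSum_logPrimeProduct {m : ℕ} (hm : 1 < m) :
    HasSum (fun p : PrimeThreeModFour => -Real.log (1 - 1 / ((p : ℕ) : ℝ) ^ m))
      (logPrimeProduct m) := by
  refine Summable.hasSum ?_
  have h : Summable fun p : PrimeThreeModFour => -(1 / ((p : ℕ) : ℝ) ^ m) :=
    ((Real.summable_one_div_nat_pow.mpr hm).comp_injective Subtype.val_injective).neg
  simpa only [sub_eq_add_neg] using (Real.summable_log_one_add_of_summable h).neg

lemma hasProd_exp_logPrimeProduct {m : ℕ} (hm : 1 < m) :
    HasProd (fun p : PrimeThreeModFour => (1 - 1 / ((p : ℕ) : ℝ) ^ m)⁻¹)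
      (Real.exp (logPrimeProduct m)) := by
  convert! (hasSum_logPrimeProduct hm).rexp using 2 with p
  have := p.one_div_pow_mem (m := m) (by omega)
  rw [Function.comp_apply, Real.exp_neg, Real.exp_log (by linarith)]

lemma logPrimeProduct_nonneg {m : ℕ} (hm : 1 < m) : 0 ≤ logPrimeProduct m := by
  refine (hasSum_logPrimeProduct hm).nonneg fun p => ?_
  have := p.one_div_pow_mem (m := m) (by omega)
  have := Real.log_nonpos (x := 1 - 1 / ((p : ℕ) : ℝ) ^ m) (by linarith) (by linarith)
  linarith

lemma logPrimeProduct_anti {m n : ℕ} (hm : 1 < m) (hmn : m ≤ n) :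
    logPrimeProduct n ≤ logPrimeProduct m := by
  refine hasSum_le (fun p => ?_) (hasSum_logPrimeProduct (hm.trans_le hmn))
    (hasSum_logPrimeProduct hm)
  have h := p.one_div_pow_mem (m := m) (by omega)
  have hp : (1 : ℝ) ≤ (p : ℕ) := by exact_mod_cast p.2.1.one_lt.le
  have hle : 1 / ((p : ℕ) : ℝ) ^ n ≤ 1 / ((p : ℕ) : ℝ) ^ m :=
    one_div_le_one_div_of_le (by positivity) (pow_le_pow_right₀ hp hmn)
  exact neg_le_neg (Real.log_le_log (by linarith) (by linarith))

/-- The Euler product of `(1 - 2 ^ (-m)) * ζ(m) / β(m)`. -/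
lemma hasProd_zeta_div_beta {m : ℕ} (hm : 1 < m) :
    HasProd (fun p : PrimeThreeModFour =>
        (1 + 1 / ((p : ℕ) : ℂ) ^ m) * (1 - 1 / ((p : ℕ) : ℂ) ^ m)⁻¹)
      ((1 - 1 / (2 : ℂ) ^ m) * riemannZeta (m : ℂ) / dirichletBeta (m : ℂ)) := by
  have hs : 1 < (m : ℂ).re := by simpa using hm
  have hζ := riemannZeta_eulerProduct_hasProd hs
  have hβ := DirichletCharacter.LSeries_eulerProduct_hasProd chiFour hs
  have hβ0 := DirichletCharacter.LSeries_ne_zero_of_one_lt_re chiFour hs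
  rw [← dirichletBeta_eq_LSeries] at hβ hβ0
  have htwo := hasProd_ite_eq (⟨2, Nat.prime_two⟩ : {q : ℕ // q.Prime}) (1 - 1 / (2 : ℂ) ^ m)
  have hall := (htwo.mul hζ).div₀ hβ hβ0
  let ι : PrimeThreeModFour → {q : ℕ // q.Prime} := fun p => ⟨p, p.2.1⟩
  have hι : Function.Injective ι := fun a b h =>
    Subtype.ext (congrArg (fun q : {q : ℕ // q.Prime} => (q : ℕ)) h)
  have hcpow (p : ℕ) : (p : ℂ) ^ (-(m : ℂ)) = 1 / (p : ℂ) ^ m := by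
    rw [Complex.cpow_neg, Complex.cpow_natCast, one_div]
  have hne (p : ℕ) (hp : p.Prime) : 1 - 1 / (p : ℂ) ^ m ≠ 0 := by
    intro h
    have h1 : (p : ℂ) ^ m = 1 := by
      have := hp.ne_zero
      field_simp at h
      linear_combination h
    have h2 : p ^ m = 1 := by exact_mod_cast h1
    exact (Nat.one_lt_pow (by omega) hp.one_lt).ne' h2
  have hres := (hι.hasProd_iff (a := _) ?_).mpr hall
  · convert! hres using 2 with p
    have hp : (ι p : ℕ) = p := rfl
    have hp2 : ι p ≠ ⟨2, Nat.prime_two⟩ := fun h => by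
      have h2 : (p : ℕ) = 2 := congrArg (fun q : {q : ℕ // q.Prime} => (q : ℕ)) h
      have := p.2.2
      omega
    have := p.2.2
    rw [Function.comp_apply, if_neg hp2, hp, hcpow, chiFour_natCast, if_neg (by omega),
      if_neg (by omega)]
    rw [one_mul, neg_one_mul, sub_neg_eq_add, div_inv_eq_mul, mul_comm]
  · rintro ⟨p, hp⟩ hpι
    have h3 : p % 4 ≠ 3 := fun h => hpι ⟨⟨p, hp, h⟩, rfl⟩
    rcases hp.eq_two_or_odd with rfl | hodd
    · have h0 : chiFour ((2 : ℕ) : ZMod 4) = 0 := by rw [chiFour_natCast]; rfl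
      have := hne 2 hp
      simp only [if_true, hcpow, h0, zero_mul, sub_zero, inv_one, div_one]
      exact mul_inv_cancel₀ this
    · have hp2 : (⟨p, hp⟩ : {q : ℕ // q.Prime}) ≠ ⟨2, Nat.prime_two⟩ := fun h => by
        have h2 : p = 2 := congrArg (fun q : {q : ℕ // q.Prime} => (q : ℕ)) h
        omega
      have := hne p hp
      simp only [if_neg hp2, hcpow, chiFour_natCast, if_neg (show ¬ p % 2 = 0 by omega),
        if_pos (show p % 4 = 1 by omega), one_mul]
      exact div_self (inv_ne_zero this)

lemma zeta_div_beta_eq_exp {m : ℕ} (hm : 1 < m) :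
    (1 - 1 / (2 : ℂ) ^ m) * riemannZeta (m : ℂ) / dirichletBeta (m : ℂ) =
      (Real.exp (2 * logPrimeProduct m - logPrimeProduct (2 * m)) : ℂ) := by
  have h := (((hasSum_logPrimeProduct hm).mul_left 2).sub
    (hasSum_logPrimeProduct (m := 2 * m) (by omega))).rexp.map Complex.ofRealHom
      Complex.continuous_ofReal
  refine (hasProd_zeta_div_beta hm).unique ?_
  convert! h using 2 with p
  obtain ⟨h0, h1⟩ := p.one_div_pow_mem (m := m) (by omega)
  set x : ℝ := 1 / ((p : ℕ) : ℝ) ^ m with hx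
  have hx2 : 1 / ((p : ℕ) : ℝ) ^ (2 * m) = x ^ 2 := by
    rw [hx, div_pow, one_pow, ← pow_mul, mul_comm]
  have hfac : 1 - x ^ 2 = (1 - x) * (1 + x) := by ring
  have hexp : Real.exp (2 * -Real.log (1 - x) - -Real.log (1 - x ^ 2)) = (1 + x) * (1 - x)⁻¹ := by
    rw [hfac, Real.log_mul (by linarith) (by linarith)]
    rw [show 2 * -Real.log (1 - x) - -(Real.log (1 - x) + Real.log (1 + x)) =
      Real.log (1 + x) + -Real.log (1 - x) by ring, Real.exp_add, Real.exp_neg,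
      Real.exp_log (by linarith), Real.exp_log (by linarith)]
  change _ = ((Real.exp (2 * -Real.log (1 - x) -
    -Real.log (1 - 1 / ((p : ℕ) : ℝ) ^ (2 * m))) : ℝ) : ℂ)
  rw [hx2, hexp, hx]
  push_cast
  rfl

lemma hasSum_telescoping_logPrimeProduct :
    HasSum (fun k : ℕ => (2 * logPrimeProduct (2 ^ (k + 1)) -
        logPrimeProduct (2 * 2 ^ (k + 1))) * (1 / 2 ^ (k + 2)))
      (logPrimeProduct 2 / 2) := by
  have hlt (k : ℕ) : 1 < 2 ^ (k + 1) := Nat.one_lt_two_pow (by omega)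
  rw [hasSum_iff_tendsto_nat_of_nonneg]
  · let g : ℕ → ℝ := fun k => logPrimeProduct (2 ^ (k + 1)) / 2 ^ (k + 1)
    have hsum (n : ℕ) : ∑ k ∈ Finset.range n, (2 * logPrimeProduct (2 ^ (k + 1)) -
        logPrimeProduct (2 * 2 ^ (k + 1))) * (1 / 2 ^ (k + 2)) = logPrimeProduct 2 / 2 - g n := by
      have hg0 : logPrimeProduct 2 / 2 = g 0 := by simp [g]
      rw [hg0, ← Finset.sum_range_sub']
      refine Finset.sum_congr rfl fun k _ => ?_
      have h2 : 2 * 2 ^ (k + 1) = 2 ^ (k + 1 + 1) := by ring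
      simp only [g, h2]
      field_simp
      ring
    simp only [hsum]
    suffices hg : Tendsto g atTop (𝓝 0) by simpa using hg.const_sub (logPrimeProduct 2 / 2)
    have hgeom : Tendsto (fun k : ℕ => logPrimeProduct 2 * (1 / 2) ^ (k + 1)) atTop (𝓝 0) := by
      have := ((tendsto_pow_atTop_nhds_zero_of_lt_one (r := (1 / 2 : ℝ)) (by norm_num)
        (by norm_num)).comp (tendsto_add_atTop_nat 1)).const_mul (logPrimeProduct 2)
      simpa using this
    refine squeeze_zero (fun k => ?_) (fun k => ?_) hgeom
    · exact div_nonneg (logPrimeProduct_nonneg (hlt k)) (by positivity)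
    · rw [one_div_pow, ← div_eq_mul_one_div]
      exact div_le_div_of_nonneg_right (logPrimeProduct_anti (by norm_num) (hlt k)) (by positivity)
  · intro k
    have h1 := logPrimeProduct_nonneg (hlt k)
    have h2 := logPrimeProduct_anti (n := 2 * 2 ^ (k + 1)) (hlt k) (by omega)
    exact mul_nonneg (by linarith) (by positivity)

lemma hasProd_sparse_zeta_div_beta :
    HasProd (fun k : ℕ =>
      ((1 - 1 / (2 : ℂ) ^ (2 ^ (k + 1) : ℕ)) *
          riemannZeta ((2 ^ (k + 1) : ℕ) : ℂ) / dirichletBeta ((2 ^ (k + 1) : ℕ) : ℂ)) ^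
        ((1 : ℂ) / 2 ^ (k + 2))) (Real.exp (logPrimeProduct 2 / 2) : ℂ) := by
  have h := hasSum_telescoping_logPrimeProduct.rexp.map Complex.ofRealHom
    Complex.continuous_ofReal
  convert! h using 2 with k
  rw [zeta_div_beta_eq_exp (Nat.one_lt_two_pow (by omega))]
  simp only [Function.comp_apply, Complex.ofRealHom_eq_coe]
  rw [Real.exp_mul, Complex.ofReal_cpow (Real.exp_pos _).le]
  push_cast
  rfl

/-- the Landau–Ramanujan constant
`λ = ((1/2) ∏_{p prime, p ≡ 3 mod 4} 1/(1 - p^(-2)))^(1/2)` satisfies the sparse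
zeta-expansion of Flajolet–Vardi:
`λ = (1/√2) ∏_{n=1}^∞ [(1 - 2^(-2^n)) ζ(2^n)/β(2^n)]^(1/2^(n+1))`, where the infinite
product over `n` converges (the product is indexed by `n = k + 1`, `k ≥ 0`). -/
theorem landau_ramanujan_sparse_product :
    Multipliable (fun k : ℕ =>
      ((1 - 1 / (2 : ℂ) ^ (2 ^ (k + 1) : ℕ)) *
          riemannZeta ((2 ^ (k + 1) : ℕ) : ℂ) / dirichletBeta ((2 ^ (k + 1) : ℕ) : ℂ)) ^
        ((1 : ℂ) / 2 ^ (k + 2))) ∧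
    ((((1 / 2) * ∏' p : {p : ℕ // p.Prime ∧ p % 4 = 3},
          (1 - 1 / ((p : ℕ) : ℝ) ^ 2)⁻¹) ^ ((1 : ℝ) / 2) : ℝ) : ℂ) =
      (1 / (Real.sqrt 2 : ℂ)) *
        ∏' k : ℕ,
          ((1 - 1 / (2 : ℂ) ^ (2 ^ (k + 1) : ℕ)) *
              riemannZeta ((2 ^ (k + 1) : ℕ) : ℂ) / dirichletBeta ((2 ^ (k + 1) : ℕ) : ℂ)) ^
            ((1 : ℂ) / 2 ^ (k + 2)) := by
  refine ⟨hasProd_sparse_zeta_div_beta.multipliable, ?_⟩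
  rw [hasProd_sparse_zeta_div_beta.tprod_eq,
    (hasProd_exp_logPrimeProduct one_lt_two).tprod_eq, Real.mul_rpow (by norm_num)
    (Real.exp_pos _).le, ← Real.exp_mul, ← Real.sqrt_eq_rpow, mul_one_div,
    Real.sqrt_div zero_le_one, Real.sqrt_one]
  push_cast
  rfl
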